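/- arXiv:2111.08241 — 3 statements merged into one kernel-verified Lean document; each statement's English description precedes it below -/
import Mathlib

section
/- Let n ≥ 1, α ≥ 1, and let w be a modulus of continuity satisfying the Dini condition. Then ∫₀^∞ { (t+1)^{−n} w((1+α)t) }² dt/t ≤ C log(2+α) [w]_Dini², where C depends only on n. -/
open MeasureTheory Set

noncomputable section

/-- A modulus of continuity: an increasing positive function on `(0,1]`,
extended by `w(t) = w(1)` for `t > 1`. -/
def IsMOC (w : ℝ → ℝ) : Prop :=
  (∀ t : ℝ, 0 < t → 0 < w t) ∧
  (∀ ⦃s t : ℝ⦄, 0 < s → s ≤ t → t ≤ 1 → w s ≤ w t) ∧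
  (∀ t : ℝ, 1 ≤ t → w t = w 1)

/-- The Dini constant `[w]_Dini = ∫₀¹ w(t)/t dt + w(1)`. -/
noncomputable def diniConst (w : ℝ → ℝ) : ℝ :=
  (∫ t in Set.Ioc (0 : ℝ) 1, w t / t) + w 1

/-- The Dini condition: `∫₀¹ w(t)/t dt < ∞`. -/
def SatisfiesDini (w : ℝ → ℝ) : Prop :=
  MeasureTheory.IntegrableOn (fun t => w t / t) (Set.Ioc (0 : ℝ) 1)

/-- `∫₀^∞ {(t+1)^{−n} w((1+α)t)}² dt/t ≤ C log(2+α) [w]_Dini²`,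
with `C` depending only on `n`. -/
theorem stmt2 (n : ℕ) (hn : 1 ≤ n) :
    ∃ C > 0, ∀ α : ℝ, 1 ≤ α → ∀ w : ℝ → ℝ, IsMOC w → SatisfiesDini w →
      (∫ t in Set.Ioi (0 : ℝ), (w ((1 + α) * t) / (t + 1) ^ n) ^ 2 / t) ≤
        C * Real.log (2 + α) * diniConst w ^ 2 := by
  refine ⟨2, two_pos, fun α hα w hw hD => ?_⟩
  obtain ⟨hpos, hmono, hconst⟩ := hw
  have ha : 0 < 1 + α := by linarith
  have hw1 : 0 < w 1 := hpos 1 one_pos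
  have hwle : ∀ t, 0 < t → w t ≤ w 1 := fun t ht =>
    (le_total t 1).elim (fun h => hmono ht h le_rfl) (fun h => (hconst t h).le)
  set h : ℝ → ℝ := (Ioc (0 : ℝ) 1).indicator fun t => w t / t with hh
  have hhint : Integrable h := (integrable_indicator_iff measurableSet_Ioc).2 hD
  have hhnn : ∀ t, 0 ≤ h t := fun t =>
    indicator_nonneg (fun s hs => (div_pos (hpos s hs.1) hs.1).le) t
  set I := ∫ t in Ioc (0 : ℝ) 1, w t / t
  have hI0 : 0 ≤ I :=
    setIntegral_nonneg measurableSet_Ioc fun t ht => (div_pos (hpos t ht.1) ht.1).le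
  have hhI : ∫ t, h ((1 + α) * t) = (1 + α)⁻¹ * I := by
    rw [Measure.integral_comp_mul_left h, abs_of_pos (inv_pos.2 ha), smul_eq_mul, hh,
      integral_indicator measurableSet_Ioc]
  have ha1 : (1 + α)⁻¹ ≤ 1 := inv_le_one_of_one_le₀ (by linarith)
  have hinv : 0 < (1 + α)⁻¹ := inv_pos.2 ha
  have hmid : IntegrableOn (fun t : ℝ => t⁻¹) (Ioc (1 + α)⁻¹ 1) := by
    rw [← intervalIntegrable_iff_integrableOn_Ioc_of_le ha1]
    exact intervalIntegral.intervalIntegrable_inv (fun x hx => by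
      rw [uIcc_of_le ha1] at hx; exact (hinv.trans_le hx.1).ne') continuousOn_id
  have hmidI : ∫ t in Ioc (1 + α)⁻¹ 1, (t : ℝ)⁻¹ = Real.log (1 + α) := by
    rw [← intervalIntegral.integral_of_le ha1, integral_inv_of_pos hinv one_pos]
    simp
  have htail : IntegrableOn (fun t : ℝ => t ^ (-2 : ℝ)) (Ioi 1) :=
    integrableOn_Ioi_rpow_of_lt (by norm_num) one_pos
  have htailI : ∫ t in Ioi (1 : ℝ), (t : ℝ) ^ (-2 : ℝ) = 1 := by
    rw [integral_Ioi_rpow_of_lt (by norm_num) one_pos]; norm_num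
  set g₁ : ℝ → ℝ := fun t => w 1 * (1 + α) * h ((1 + α) * t)
  set g₂ : ℝ → ℝ := fun t => w 1 ^ 2 * (Ioc (1 + α)⁻¹ 1).indicator (fun t : ℝ => t⁻¹) t
  set g₃ : ℝ → ℝ := fun t => w 1 ^ 2 * (Ioi 1).indicator (fun t : ℝ => t ^ (-2 : ℝ)) t
  have hg₁ : Integrable g₁ := (hhint.comp_mul_left' ha.ne').const_mul _
  have hg₂ : Integrable g₂ :=
    ((integrable_indicator_iff measurableSet_Ioc).2 hmid).const_mul _
  have hg₃ : Integrable g₃ :=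
    ((integrable_indicator_iff measurableSet_Ioi).2 htail).const_mul _
  have hg₁0 : ∀ t, 0 ≤ g₁ t := fun t => mul_nonneg (by positivity) (hhnn _)
  have hg₂0 : ∀ t, 0 ≤ g₂ t := fun t => mul_nonneg (by positivity)
    (indicator_nonneg (fun s hs => (inv_pos.2 (hinv.trans hs.1)).le) t)
  have hg₃0 : ∀ t, 0 ≤ g₃ t := fun t => mul_nonneg (by positivity)
    (indicator_nonneg (fun s hs => Real.rpow_nonneg (zero_le_one.trans (le_of_lt hs)) _) t)
  have hgint : Integrable (fun t => g₁ t + g₂ t + g₃ t) := (hg₁.add hg₂).add hg₃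
  have hgI : ∫ t, (g₁ t + g₂ t + g₃ t) = w 1 * I + w 1 ^ 2 * (Real.log (1 + α) + 1) := by
    rw [integral_add (f := fun t => g₁ t + g₂ t) (hg₁.add hg₂) hg₃, integral_add hg₁ hg₂, integral_const_mul,
      integral_const_mul, integral_const_mul, hhI, integral_indicator measurableSet_Ioc,
      integral_indicator measurableSet_Ioi, hmidI, htailI]
    field_simp
    ring
  have hpt : ∀ t ∈ Ioi (0 : ℝ),
      (w ((1 + α) * t) / (t + 1) ^ n) ^ 2 / t ≤ g₁ t + g₂ t + g₃ t := by
    intro t ht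
    have ht : 0 < t := ht
    have hat : 0 < (1 + α) * t := mul_pos ha ht
    have hwa := hpos _ hat
    have hwa1 := hwle _ hat
    have hden : t + 1 ≤ (t + 1) ^ n := le_self_pow₀ (by linarith) (by omega)
    have hfrac : w ((1 + α) * t) / (t + 1) ^ n ≤ w ((1 + α) * t) :=
      div_le_self hwa.le (by linarith)
    have hfrac0 : 0 ≤ w ((1 + α) * t) / (t + 1) ^ n := by positivity
    rcases le_or_gt t (1 + α)⁻¹ with h1 | h1
    · have hmem : (1 + α) * t ∈ Ioc (0 : ℝ) 1 :=
        ⟨hat, (mul_le_mul_of_nonneg_left h1 ha.le).trans (mul_inv_cancel₀ ha.ne').le⟩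
      have e : g₁ t = w 1 * w ((1 + α) * t) / t := by
        simp only [g₁, hh, indicator_of_mem hmem]
        field_simp
      have : (w ((1 + α) * t) / (t + 1) ^ n) ^ 2 / t ≤ g₁ t := by
        rw [e]
        gcongr
        nlinarith
      linarith [hg₂0 t, hg₃0 t]
    rcases le_or_gt t 1 with h2 | h2
    · have e : g₂ t = w 1 ^ 2 / t := by
        simp only [g₂, indicator_of_mem (show t ∈ Ioc (1 + α)⁻¹ 1 from ⟨h1, h2⟩)]
        rfl
      have : (w ((1 + α) * t) / (t + 1) ^ n) ^ 2 / t ≤ g₂ t := by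
        rw [e]
        gcongr
        exact hfrac.trans hwa1
      linarith [hg₁0 t, hg₃0 t]
    · have e : g₃ t = w 1 ^ 2 / t ^ 2 := by
        simp only [g₃, indicator_of_mem (show t ∈ Ioi (1 : ℝ) from h2)]
        rw [Real.rpow_neg ht.le, Real.rpow_two]
        rfl
      have : (w ((1 + α) * t) / (t + 1) ^ n) ^ 2 / t ≤ g₃ t := by
        rw [e, div_pow, div_div]
        gcongr
        nlinarith
      linarith [hg₁0 t, hg₂0 t]
  have hmain : (∫ t in Ioi (0 : ℝ), (w ((1 + α) * t) / (t + 1) ^ n) ^ 2 / t) ≤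
      w 1 * I + w 1 ^ 2 * (Real.log (1 + α) + 1) := by
    rw [← hgI]
    refine (integral_mono_of_nonneg ?_ hgint.integrableOn ?_).trans
      (setIntegral_le_integral hgint (.of_forall fun t =>
        add_nonneg (add_nonneg (hg₁0 t) (hg₂0 t)) (hg₃0 t)))
    · filter_upwards [ae_restrict_mem measurableSet_Ioi] with t ht
      exact div_nonneg (sq_nonneg _) (le_of_lt ht)
    · filter_upwards [ae_restrict_mem measurableSet_Ioi] with t ht
      exact hpt t ht
  have hlog1 : 1 ≤ Real.log (2 + α) := by
    rw [Real.le_log_iff_exp_le (by linarith)]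
    linarith [Real.exp_one_lt_d9]
  have hlog : Real.log (1 + α) ≤ Real.log (2 + α) := Real.log_le_log ha (by linarith)
  refine hmain.trans ?_
  change _ ≤ 2 * Real.log (2 + α) * (I + w 1) ^ 2
  have hwI : 0 ≤ w 1 * I := by positivity
  calc w 1 * I + w 1 ^ 2 * (Real.log (1 + α) + 1)
      ≤ w 1 * I * (2 * Real.log (2 + α)) + w 1 ^ 2 * (2 * Real.log (2 + α)) := by
        refine add_le_add (le_mul_of_one_le_right hwI (by linarith)) ?_
        gcongr
        linarith
    _ = 2 * Real.log (2 + α) * (w 1 * I + w 1 ^ 2) := by ring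
    _ ≤ 2 * Real.log (2 + α) * (I + w 1) ^ 2 := by
        gcongr
        nlinarith [sq_nonneg I]

end
end

section
/- Let n ≥ 1, let w be a modulus of continuity satisfying the Dini condition, and fix m ∈ ℕ. Then for every cube Q ⊂ ℝⁿ, Σ_{k=1}^∞ 2^{−kn/2} ∫_{ℝⁿ} (2^k ℓ(Q) + |x − c(Q)|)^{−n} w( 2^{k+m} ℓ(Q) / (2^k ℓ(Q) + |x − c(Q)|) ) dx ≤ C [w]_Dini, where C depends only on n and m. -/
open MeasureTheory Set

noncomputable section

abbrev Eu (n : ℕ) : Type := EuclideanSpace ℝ (Fin n)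

lemma IsMOC.div_self_nonneg {w : ℝ → ℝ} (hw : IsMOC w) {t : ℝ} (ht : 0 < t) : 0 ≤ w t / t :=
  (div_pos (hw.1 t ht) ht).le

lemma integrableOn_div_Ioc_one (a M : ℝ) :
    IntegrableOn (fun t : ℝ => a / t) (Ioc 1 M) := by
  refine IntegrableOn.mono_set (ContinuousOn.integrableOn_Icc ?_) Ioc_subset_Icc_self
  exact continuousOn_const.div continuousOn_id fun t ht => (zero_lt_one.trans_le ht.1).ne'

lemma IsMOC.integrableOn_Ioc {w : ℝ → ℝ} (hw : IsMOC w) (hd : SatisfiesDini w)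
    {M : ℝ} (hM : 1 ≤ M) : IntegrableOn (fun t => w t / t) (Ioc 0 M) := by
  rw [← Ioc_union_Ioc_eq_Ioc zero_le_one hM]
  refine IntegrableOn.union hd ((integrableOn_div_Ioc_one (w 1) M).congr_fun ?_ measurableSet_Ioc)
  intro t ht
  simp only [hw.2.2 t ht.1.le]

lemma IsMOC.diniConst_pos {w : ℝ → ℝ} (hw : IsMOC w) : 0 < diniConst w :=
  add_pos_of_nonneg_of_pos
    (setIntegral_nonneg measurableSet_Ioc fun _ ht => hw.div_self_nonneg ht.1) (hw.1 1 one_pos)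

lemma IsMOC.setIntegral_Ioc_le {w : ℝ → ℝ} (hw : IsMOC w) (hd : SatisfiesDini w)
    {M : ℝ} (hM : 1 ≤ M) : ∫ t in Ioc 0 M, w t / t ≤ M * diniConst w := by
  have hi := hw.integrableOn_Ioc hd hM
  have h1 : 0 < w 1 := hw.1 1 one_pos
  have h0 : 0 ≤ ∫ t in Ioc (0 : ℝ) 1, w t / t :=
    setIntegral_nonneg measurableSet_Ioc fun _ ht => hw.div_self_nonneg ht.1
  have h2 : ∫ t in Ioc 1 M, w t / t ≤ ∫ _ in Ioc 1 M, w 1 := by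
    refine setIntegral_mono_on (hi.mono_set (Ioc_subset_Ioc_left zero_le_one))
      (by simp) measurableSet_Ioc fun t ht => ?_
    rw [hw.2.2 t ht.1.le]
    exact div_le_self h1.le ht.1.le
  have h3 : ∫ _ in Ioc 1 M, w 1 = (M - 1) * w 1 := by
    simp [hM]
  rw [← Ioc_union_Ioc_eq_Ioc zero_le_one hM, setIntegral_union (Ioc_disjoint_Ioc_of_le le_rfl)
    measurableSet_Ioc hd (hi.mono_set (Ioc_subset_Ioc_left zero_le_one))]
  unfold diniConst
  nlinarith [mul_nonneg (sub_nonneg.2 hM) h0]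

lemma IsMOC.integral_Ioi_le {w : ℝ → ℝ} (hw : IsMOC w) (hd : SatisfiesDini w)
    {M : ℝ} (hM : 1 ≤ M) :
    IntegrableOn (fun y => w (M / (1 + y)) / (1 + y)) (Ioi 0) ∧
      ∫ y in Ioi 0, w (M / (1 + y)) / (1 + y) ≤ M * diniConst w := by
  have hM0 : 0 < M := one_pos.trans_le hM
  have hderiv : ∀ y ∈ Ioi (0 : ℝ),
      HasDerivWithinAt (fun y => M / (1 + y)) (-M / (1 + y) ^ 2) (Ioi 0) y := by
    intro y hy
    have hy' : (0 : ℝ) < 1 + y := add_pos one_pos hy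
    have h := ((hasDerivAt_const y M).div ((hasDerivAt_id y).const_add 1) hy'.ne').hasDerivWithinAt
      (s := Ioi 0)
    refine h.congr_deriv ?_
    simp
  have hinj : InjOn (fun y => M / (1 + y)) (Ioi (0 : ℝ)) := by
    intro x hx y hy hxy
    have hx' : (0 : ℝ) < 1 + x := add_pos one_pos hx
    have hy' : (0 : ℝ) < 1 + y := add_pos one_pos hy
    have : M / (1 + x) = M / (1 + y) := hxy
    rw [div_eq_div_iff hx'.ne' hy'.ne'] at this
    linarith [mul_left_cancel₀ hM0.ne' this]
  have himg : (fun y => M / (1 + y)) '' Ioi (0 : ℝ) ⊆ Ioc 0 M := by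
    rintro _ ⟨y, hy, rfl⟩
    have hy0 : (0 : ℝ) < y := hy
    exact ⟨by positivity, div_le_self hM0.le (by linarith)⟩
  have hcongr : EqOn (fun y => |-M / (1 + y) ^ 2| • (w (M / (1 + y)) / (M / (1 + y))))
      (fun y => w (M / (1 + y)) / (1 + y)) (Ioi 0) := by
    intro y hy
    have hy' : (0 : ℝ) < 1 + y := add_pos one_pos hy
    have : |-M / (1 + y) ^ 2| = M / (1 + y) ^ 2 := by
      rw [neg_div, abs_neg, abs_of_pos (by positivity)]
    simp only [this, smul_eq_mul]
    field_simp
  have hi := hw.integrableOn_Ioc hd hM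
  constructor
  · exact ((integrableOn_image_iff_integrableOn_abs_deriv_smul measurableSet_Ioi hderiv hinj
      (fun t => w t / t)).1 (hi.mono_set himg)).congr_fun hcongr measurableSet_Ioi
  · rw [← setIntegral_congr_fun measurableSet_Ioi hcongr,
      ← integral_image_eq_integral_abs_deriv_smul measurableSet_Ioi hderiv hinj (fun t => w t / t)]
    refine (setIntegral_mono_set hi ?_ himg.eventuallyLE).trans (hw.setIntegral_Ioc_le hd hM)
    exact (ae_restrict_iff' measurableSet_Ioc).2 (.of_forall fun t ht => hw.div_self_nonneg ht.1)

lemma IsMOC.integral_radial_le {w : ℝ → ℝ} (hw : IsMOC w) (hd : SatisfiesDini w)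
    {n : ℕ} (hn : 1 ≤ n) {M : ℝ} (hM : 1 ≤ M) :
    ∫ x : Eu n, w (M / (1 + ‖x‖)) / (1 + ‖x‖) ^ n ≤
      n * volume.real (Metric.ball (0 : Eu n) 1) * (M * diniConst w) := by
  have : Nonempty (Fin n) := ⟨⟨0, hn⟩⟩
  obtain ⟨hi, hle⟩ := hw.integral_Ioi_le hd hM
  have hM0 : 0 < M := one_pos.trans_le hM
  rw [integral_fun_norm_addHaar (volume : Measure (Eu n))
    (fun r => w (M / (1 + r)) / (1 + r) ^ n), finrank_euclideanSpace_fin, nsmul_eq_mul,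
    smul_eq_mul, mul_assoc]
  gcongr
  refine le_trans (integral_mono_of_nonneg ?_ hi ?_) hle
  · refine (ae_restrict_iff' measurableSet_Ioi).2 (.of_forall fun y (hy : 0 < y) => ?_)
    have := hw.1 (M / (1 + y)) (by positivity)
    simp only [Pi.zero_apply, smul_eq_mul]
    positivity
  · refine (ae_restrict_iff' measurableSet_Ioi).2 (.of_forall fun y (hy : 0 < y) => ?_)
    have := hw.1 (M / (1 + y)) (by positivity)
    have hp : y ^ (n - 1) ≤ (1 + y) ^ (n - 1) := by gcongr; linarith
    have hs : (1 + y) ^ n = (1 + y) ^ (n - 1) * (1 + y) := by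
      rw [← pow_succ, Nat.sub_add_cancel hn]
    simp only [smul_eq_mul]
    rw [hs, ← mul_div_assoc, div_le_div_iff₀ (by positivity) (by positivity)]
    calc y ^ (n - 1) * w (M / (1 + y)) * (1 + y)
        ≤ (1 + y) ^ (n - 1) * w (M / (1 + y)) * (1 + y) := by gcongr
      _ = _ := by ring

lemma integral_dilate_translate (w : ℝ → ℝ) (n : ℕ) (M : ℝ) (c : Eu n) {R : ℝ} (hR : 0 < R) :
    ∫ x : Eu n, w (M * R / (R + ‖x - c‖)) / (R + ‖x - c‖) ^ n =
      ∫ x : Eu n, w (M / (1 + ‖x‖)) / (1 + ‖x‖) ^ n := by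
  rw [integral_sub_right_eq_self (fun x : Eu n => w (M * R / (R + ‖x‖)) / (R + ‖x‖) ^ n) c]
  have h := Measure.integral_comp_smul_of_nonneg (volume : Measure (Eu n))
    (fun x : Eu n => w (M * R / (R + ‖x‖)) / (R + ‖x‖) ^ n) R (hR := hR.le)
  rw [finrank_euclideanSpace_fin, smul_eq_mul, eq_inv_mul_iff_mul_eq₀ (by positivity),
    ← integral_const_mul] at h
  rw [← h]
  congr 1 with x
  have h1 : R + ‖R • x‖ = R * (1 + ‖x‖) := by
    rw [norm_smul, Real.norm_of_nonneg hR.le]; ring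
  have h2 : M * R / (R * (1 + ‖x‖)) = M / (1 + ‖x‖) := by field_simp
  rw [h1, h2, mul_pow]
  field_simp

/-- for every cube `Q` (center `c`, side length `ℓ`),
`Σ_{k=1}^∞ 2^{−kn/2} ∫ (2^k ℓ + |x−c|)^{−n} w(2^{k+m} ℓ/(2^k ℓ + |x−c|)) dx ≤ C [w]_Dini`,
with `C` depending only on `n` and `m`. -/
theorem stmt6 (n : ℕ) (hn : 1 ≤ n) (m : ℕ) :
    ∃ C > 0, ∀ w : ℝ → ℝ, IsMOC w → SatisfiesDini w →
      ∀ (c : Eu n) (ℓ : ℝ), 0 < ℓ →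
        ∑' k : ℕ,
          (2 : ℝ) ^ (-(((k : ℝ) + 1) * n) / 2) *
            ∫ x : Eu n,
              w (2 ^ (k + 1 + m) * ℓ / (2 ^ (k + 1) * ℓ + ‖x - c‖)) /
                (2 ^ (k + 1) * ℓ + ‖x - c‖) ^ n
        ≤ C * diniConst w := by
  set S : ℝ := ∑' k : ℕ, (2 : ℝ) ^ (-(((k : ℝ) + 1) * n) / 2)
  have hS : 0 ≤ S := tsum_nonneg fun k => by positivity
  set V : ℝ := n * volume.real (Metric.ball (0 : Eu n) 1)
  have hV : 0 ≤ V := by positivity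
  refine ⟨S * (V * 2 ^ m) + 1, by positivity, fun w hw hd c ℓ hℓ => ?_⟩
  have hscale : ∀ k : ℕ, ∫ x : Eu n,
      w (2 ^ (k + 1 + m) * ℓ / (2 ^ (k + 1) * ℓ + ‖x - c‖)) /
        (2 ^ (k + 1) * ℓ + ‖x - c‖) ^ n =
      ∫ x : Eu n, w (2 ^ m / (1 + ‖x‖)) / (1 + ‖x‖) ^ n := fun k => by
    rw [← integral_dilate_translate w n (2 ^ m) c (R := 2 ^ (k + 1) * ℓ) (by positivity),
      show (2 : ℝ) ^ (k + 1 + m) * ℓ = 2 ^ m * (2 ^ (k + 1) * ℓ) by ring]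
  simp_rw [hscale]
  rw [tsum_mul_right]
  have hI := hw.integral_radial_le hd hn (one_le_pow₀ one_le_two : (1 : ℝ) ≤ 2 ^ m)
  have hD := hw.diniConst_pos
  calc S * ∫ x : Eu n, w (2 ^ m / (1 + ‖x‖)) / (1 + ‖x‖) ^ n
      ≤ S * (V * (2 ^ m * diniConst w)) := mul_le_mul_of_nonneg_left hI hS
    _ ≤ (S * (V * 2 ^ m) + 1) * diniConst w := by nlinarith

end
end

section
/- Let w and φ be moduli of continuity with w satisfying the Dini condition, and let ψ : ℝⁿ × ℝⁿ → ℝ satisfy the size and smoothness conditions with constant A. Let Q ⊂ ℝⁿ be a cube and f an integrable function supported in Q with ∫_Q f(x) dx = 0. Then for all x ∈ ℝⁿ with |x − c(Q)| > 64 n ℓ(Q): S_{1,ψ} f(x) ≤ C { A [w]_Dini |x − c(Q)|^{−n} φ( 2√n ℓ(Q) / |x − c(Q)| ) ‖f‖_{L¹} + Σ_{k=1}^∞ A 2^{−kn/2} ( 2^k ℓ(Q) + |x − c(Q)| )^{−n} w( 2^{k+2} ℓ(Q) / (2^k ℓ(Q) + |x − c(Q)|) ) ‖f‖_{L¹} },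 where C depends only on n. -/
open MeasureTheory Set

noncomputable section

/-- `ψ_t f (x) = t^{-n} ∫ ψ(x/t, y/t) f(y) dy`. -/
def psiT (n : ℕ) (ψ : Eu n → Eu n → ℝ) (t : ℝ) (f : Eu n → ℝ) (x : Eu n) : ℝ :=
  (1 / t ^ n) * ∫ y : Eu n, ψ (t⁻¹ • x) (t⁻¹ • y) * f y

/-- the cone `Γ_α(x)` as a subset of `ℝⁿ × (0,∞)`. -/
def cone (n : ℕ) (α : ℝ) (x : Eu n) : Set (Eu n × ℝ) :=
  {p | 0 < p.2 ∧ ‖x - p.1‖ < α * p.2}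

/-- the square function `S_{α,ψ} f (x)`. -/
def sqFn (n : ℕ) (α : ℝ) (ψ : Eu n → Eu n → ℝ) (f : Eu n → ℝ) (x : Eu n) : ℝ :=
  Real.sqrt (∫ p in cone n α x, (psiT n ψ p.2 f p.1) ^ 2 / p.2 ^ (n + 1))

/-- the (closed, axis-parallel) cube with center `c` and side length `ℓ`. -/
def ccube (n : ℕ) (c : Eu n) (ℓ : ℝ) : Set (Eu n) := {y | ∀ i, |y i - c i| ≤ ℓ / 2}

/-- the Hardy–Littlewood maximal function. -/
def hlMax (n : ℕ) (f : Eu n → ℝ) (x : Eu n) : ℝ :=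
  ⨆ r : Set.Ioi (0 : ℝ), ⨍ y in Metric.ball x (r : ℝ), |f y|

/-- `M 1_{Q(x,1)}`, the maximal function of the indicator of the closed cube
centered at `x` of side length `2`. -/
def maxCubeInd (n : ℕ) (x : Eu n) (y : Eu n) : ℝ :=
  hlMax n (Set.indicator (ccube n x 2) fun _ => (1 : ℝ)) y

/-- the size and smoothness conditions on the kernel `ψ` with constant `A` and
moduli of continuity `φ`, `w`. -/
def KernelCond (n : ℕ) (A : ℝ) (ψ : Eu n → Eu n → ℝ) (φ w : ℝ → ℝ) : Prop :=
  (∀ x y : Eu n, |ψ x y| ≤ A * maxCubeInd n x y * w (1 / (1 + ‖x - y‖))) ∧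
  (∀ x y h : Eu n, ‖h‖ < ‖x - y‖ / 2 →
    |ψ x y - ψ (x + h) y| ≤
      A * maxCubeInd n x y * φ (‖h‖ / (1 + ‖x - y‖)) * w (1 / (1 + ‖x - y‖))) ∧
  (∀ x y h : Eu n, ‖h‖ < ‖x - y‖ / 2 →
    |ψ x y - ψ x (y + h)| ≤
      A * maxCubeInd n x y * φ (‖h‖ / (1 + ‖x - y‖)) * w (1 / (1 + ‖x - y‖)))

lemma norm_sub_le_of_mem_ccube {n : ℕ} {c y : Eu n} {ℓ : ℝ} (hℓ : 0 ≤ ℓ) (hy : y ∈ ccube n c ℓ) :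
    ‖y - c‖ ≤ √n * (ℓ / 2) := by
  rw [EuclideanSpace.norm_eq]
  refine Real.sqrt_le_iff.2 ⟨by positivity, ?_⟩
  calc ∑ i, ‖(y - c) i‖ ^ 2 ≤ ∑ _i : Fin n, (ℓ / 2) ^ 2 := by
        refine Finset.sum_le_sum fun i _ => ?_
        have h : ‖(y - c) i‖ ≤ ℓ / 2 := by simpa using hy i
        gcongr
    _ = (√n * (ℓ / 2)) ^ 2 := by
        rw [mul_pow, Real.sq_sqrt (Nat.cast_nonneg n)]; simp

lemma maxCubeInd_nonneg (n : ℕ) (u v : Eu n) : 0 ≤ maxCubeInd n u v := by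
  refine Real.iSup_nonneg fun r => ?_
  rw [setAverage_eq]
  exact smul_nonneg (by positivity) (integral_nonneg fun _ => abs_nonneg _)

lemma one_le_sqrt_natCast {n : ℕ} (hn : 1 ≤ n) : 1 ≤ √(n : ℝ) :=
  Real.one_le_sqrt.2 (by exact_mod_cast hn)

lemma volume_real_ball {n : ℕ} (u : Eu n) {r : ℝ} (hr : 0 < r) :
    volume.real (Metric.ball u r) = r ^ n * volume.real (Metric.ball (0 : Eu n) 1) := by
  rw [Measure.real, Measure.addHaar_ball_of_pos _ _ hr]
  simp [Measure.real, hr.le]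

lemma volume_real_unit_ball_pos (n : ℕ) : 0 < volume.real (Metric.ball (0 : Eu n) 1) :=
  ENNReal.toReal_pos (Metric.measure_ball_pos _ _ one_pos).ne' measure_ball_lt_top.ne

lemma setAverage_abs_indicator_le_one {n : ℕ} (s : Set (Eu n)) (v : Eu n) {r : ℝ} (hr : 0 < r) :
    ⨍ y in Metric.ball v r, |s.indicator (fun _ => (1 : ℝ)) y| ≤ 1 := by
  have hpos : 0 < volume.real (Metric.ball v r) :=
    ENNReal.toReal_pos (Metric.measure_ball_pos _ _ hr).ne' measure_ball_lt_top.ne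
  rw [setAverage_eq, smul_eq_mul, inv_mul_le_iff₀ hpos]
  have h : ∫ y in Metric.ball v r, |s.indicator (fun _ => (1 : ℝ)) y| ≤
      ∫ _y in Metric.ball v r, (1 : ℝ) := by
    refine integral_mono_of_nonneg (.of_forall fun _ => abs_nonneg _)
      (integrableOn_const measure_ball_lt_top.ne) (.of_forall fun y => ?_)
    by_cases h : y ∈ s <;> simp [h]
  simpa using h

lemma maxCubeInd_self_pos (n : ℕ) (u : Eu n) : 0 < maxCubeInd n u u := by
  have hbdd : BddAbove (range fun r : Ioi (0 : ℝ) => ⨍ y in Metric.ball u (r : ℝ),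
      |(ccube n u 2).indicator (fun _ => (1 : ℝ)) y|) :=
    ⟨1, by rintro _ ⟨⟨r, hr⟩, rfl⟩; exact setAverage_abs_indicator_le_one _ _ hr⟩
  refine lt_of_lt_of_le ?_ (le_ciSup hbdd ⟨1, mem_Ioi.2 one_pos⟩)
  have hmem : ∀ y ∈ Metric.ball u 1, |(ccube n u 2).indicator (fun _ => (1 : ℝ)) y| = 1 := by
    intro y hy
    have : y ∈ ccube n u 2 := fun i => by
      have h1 := PiLp.norm_apply_le (y - u) i
      rw [mem_ball_iff_norm] at hy
      simp only [PiLp.sub_apply, Real.norm_eq_abs] at h1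
      linarith
    simp [this]
  have hpos : 0 < volume.real (Metric.ball u 1) :=
    ENNReal.toReal_pos (Metric.measure_ball_pos _ _ one_pos).ne' measure_ball_lt_top.ne
  rw [setAverage_eq, setIntegral_congr_fun measurableSet_ball hmem]
  simp [hpos]

lemma maxCubeInd_le {n : ℕ} (hn : 1 ≤ n) (u v : Eu n) :
    maxCubeInd n u v ≤ (4 * √n) ^ n / (1 + ‖u - v‖) ^ n := by
  have hsq := one_le_sqrt_natCast hn
  have hV := volume_real_unit_ball_pos n
  have : Nonempty (Set.Ioi (0 : ℝ)) := ⟨⟨1, mem_Ioi.2 one_pos⟩⟩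
  refine ciSup_le fun ⟨r, hr⟩ => ?_
  replace hr : 0 < r := hr
  rcases le_or_gt ‖u - v‖ (2 * √n) with hnear | hfar
  · refine (setAverage_abs_indicator_le_one _ v hr).trans ?_
    rw [← div_pow]
    refine one_le_pow₀ ((one_le_div (by positivity)).2 ?_)
    linarith
  · set F : Eu n → ℝ := fun y => |(ccube n u 2).indicator (fun _ => (1 : ℝ)) y| with hF
    have hF0 : ∀ y, 0 ≤ F y := fun y => abs_nonneg _
    rw [setAverage_eq, smul_eq_mul, volume_real_ball v hr, inv_mul_le_iff₀ (by positivity)]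
    by_cases hmeet : ∃ y ∈ Metric.ball v r, y ∈ ccube n u 2
    · obtain ⟨y, hyr, hy⟩ := hmeet
      have hyu : ‖y - u‖ ≤ √n := by simpa using norm_sub_le_of_mem_ccube (by norm_num) hy
      rw [mem_ball_iff_norm] at hyr
      have htri : ‖u - v‖ ≤ ‖y - u‖ + ‖y - v‖ := by
        have := norm_sub_le (y - v) (y - u)
        rw [show y - v - (y - u) = u - v by abel] at this
        linarith
      have hr2 : ‖u - v‖ < 2 * r := by linarith
      have h1 : ∫ y in Metric.ball v r, F y ≤
          ∫ y in Metric.ball v r, (Metric.closedBall u (√n)).indicator (fun _ => (1 : ℝ)) y := by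
        refine integral_mono_of_nonneg (.of_forall hF0) ?_ (.of_forall fun y => ?_)
        · exact ((integrable_indicator_iff measurableSet_closedBall).2
            (integrableOn_const measure_closedBall_lt_top.ne)).integrableOn
        · by_cases h : y ∈ ccube n u 2
          · have : y ∈ Metric.closedBall u (√n) := by
              simpa [dist_eq_norm] using norm_sub_le_of_mem_ccube (by norm_num) h
            simp [hF, h, this]
          · simp only [hF, h, not_false_eq_true, indicator_of_notMem, abs_zero]
            exact indicator_nonneg (fun _ _ => zero_le_one) _
      have h2 : ∫ y in Metric.ball v r, (Metric.closedBall u (√n)).indicator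
          (fun _ => (1 : ℝ)) y ≤ √n ^ n * volume.real (Metric.ball (0 : Eu n) 1) := by
        refine (setIntegral_le_integral ((integrable_indicator_iff measurableSet_closedBall).2
            (integrableOn_const measure_closedBall_lt_top.ne))
            (.of_forall fun y => indicator_nonneg (fun _ _ => zero_le_one) _)).trans ?_
        rw [integral_indicator measurableSet_closedBall, setIntegral_const, smul_eq_mul, mul_one,
          Measure.real, Measure.addHaar_closedBall _ _ (by positivity)]
        simp [Measure.real]
      refine h1.trans (h2.trans ?_)
      rw [mul_right_comm]
      gcongr
      rw [mul_div_assoc', ← mul_pow, ← div_pow]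
      gcongr
      rw [le_div_iff₀ (by positivity)]
      nlinarith [norm_nonneg (u - v)]
    · push Not at hmeet
      rw [setIntegral_eq_zero_of_forall_eq_zero fun y hy => by simp [hmeet y hy]]
      positivity

/-- The size bound on `∫ k f`, improved by subtracting a constant from `k` since `f` has mean
zero. -/
lemma abs_integral_mul_le {X : Type*} [MeasurableSpace X] {μ : Measure X} {f k : X → ℝ} {a B : ℝ}
    (hf : Integrable f μ) (hf0 : ∫ x, f x ∂μ = 0) (hB : 0 ≤ B)
    (h : ∀ x, f x ≠ 0 → |k x - a| ≤ B) : |∫ x, k x * f x ∂μ| ≤ B * ∫ x, |f x| ∂μ := by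
  by_cases hk : Integrable (fun x => k x * f x) μ
  · have h1 : ∫ x, k x * f x ∂μ = ∫ x, (k x - a) * f x ∂μ := by
      simp_rw [sub_mul]
      rw [integral_sub hk (hf.const_mul a), integral_const_mul, hf0]
      simp
    rw [h1, ← integral_const_mul, ← Real.norm_eq_abs]
    refine norm_integral_le_of_norm_le (hf.abs.const_mul B) (.of_forall fun x => ?_)
    rw [Real.norm_eq_abs, abs_mul]
    by_cases hx : f x = 0
    · simp [hx]
    · exact mul_le_mul_of_nonneg_right (h x hx) (abs_nonneg _)
  · rw [integral_undef hk, abs_zero]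
    exact mul_nonneg hB (integral_nonneg fun _ => abs_nonneg _)

lemma lintegral_Ioi_inv_pow_le {m : ℕ} (hm : 1 ≤ m) {a : ℝ} (ha : 0 < a) :
    ∫⁻ t in Ioi a, ENNReal.ofReal (1 / t ^ (m + 1)) ≤ ENNReal.ofReal (1 / a ^ m) := by
  have hlt : -((m : ℝ) + 1) < -1 := by
    have : (1 : ℝ) ≤ m := by exact_mod_cast hm
    linarith
  have heq : ∀ t ∈ Ioi a, 1 / t ^ (m + 1) = t ^ (-((m : ℝ) + 1)) := fun t ht => by
    have : 0 < t := ha.trans ht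
    rw [Real.rpow_neg this.le, one_div]
    norm_cast
  rw [setLIntegral_congr_fun measurableSet_Ioi fun t ht => by rw [heq t ht],
    ← ofReal_integral_eq_lintegral_ofReal (integrableOn_Ioi_rpow_of_lt hlt ha),
    integral_Ioi_rpow_of_lt hlt ha]
  · apply ENNReal.ofReal_le_ofReal
    have h1 : -((m : ℝ) + 1) + 1 = -(m : ℝ) := by ring
    rw [h1, neg_div_neg_eq, Real.rpow_neg ha.le, Real.rpow_natCast, one_div]
    exact div_le_self (by positivity) (by exact_mod_cast hm)
  · filter_upwards [ae_restrict_mem measurableSet_Ioi] with t ht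
    exact Real.rpow_nonneg (ha.trans ht).le _

lemma measurableSet_cone (n : ℕ) (α : ℝ) (x : Eu n) : MeasurableSet (cone n α x) := by
  have h1 : IsOpen {p : Eu n × ℝ | 0 < p.2} := isOpen_lt continuous_const continuous_snd
  have h2 : IsOpen {p : Eu n × ℝ | ‖x - p.1‖ < α * p.2} :=
    isOpen_lt (by fun_prop) (by fun_prop)
  exact (h1.inter h2).measurableSet

lemma lintegral_cone_comp_snd {n : ℕ} (x : Eu n) {g : ℝ → ENNReal} (hg : Measurable g) :
    ∫⁻ p in cone n 1 x, g p.2 =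
      volume (Metric.ball (0 : Eu n) 1) * ∫⁻ t in Ioi (0 : ℝ), g t * ENNReal.ofReal (t ^ n) := by
  rw [← lintegral_indicator (measurableSet_cone n 1 x), Measure.volume_eq_prod,
    lintegral_prod_symm _ ((show Measurable fun p : Eu n × ℝ => g p.2 from
      hg.comp measurable_snd).indicator (measurableSet_cone n 1 x)).aemeasurable,
    ← lintegral_indicator measurableSet_Ioi, ← lintegral_const_mul' _ _ measure_ball_lt_top.ne]
  refine lintegral_congr fun t => ?_
  by_cases ht : 0 < t
  · have : ∀ y : Eu n, (cone n 1 x).indicator (fun p => g p.2) (y, t) =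
        (Metric.ball x t).indicator (fun _ => g t) y := fun y => by
      have hiff : (y, t) ∈ cone n 1 x ↔ y ∈ Metric.ball x t := by
        simp [cone, ht, dist_eq_norm, norm_sub_rev x y]
      by_cases hy : y ∈ Metric.ball x t
      · rw [indicator_of_mem hy, indicator_of_mem (hiff.2 hy)]
      · rw [indicator_of_notMem hy, indicator_of_notMem (mt hiff.1 hy)]
    simp_rw [this]
    rw [lintegral_indicator measurableSet_ball, setLIntegral_const,
      Measure.addHaar_ball_of_pos _ _ ht, indicator_of_mem (show t ∈ Ioi 0 from ht)]
    simp only [finrank_euclideanSpace, Fintype.card_fin]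
    ring
  · have : ∀ y : Eu n, (y, t) ∉ cone n 1 x := fun y h => ht h.1
    simp [this, ht]
/-- The extension of a modulus of continuity to a monotone function on `ℝ`, zero on
nonpositive numbers. -/
def mocExt (w : ℝ → ℝ) (s : ℝ) : ℝ := if s ≤ 0 then 0 else w (min s 1)

lemma mocExt_of_pos {w : ℝ → ℝ} {s : ℝ} (hs : 0 < s) : mocExt w s = w (min s 1) :=
  if_neg hs.not_ge

lemma IsMOC.mocExt_nonneg {w : ℝ → ℝ} (hw : IsMOC w) (s : ℝ) : 0 ≤ mocExt w s := by
  unfold mocExt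
  split_ifs with h
  · exact le_rfl
  · exact (hw.1 _ (lt_min (not_le.1 h) one_pos)).le

lemma IsMOC.monotone_mocExt {w : ℝ → ℝ} (hw : IsMOC w) : Monotone (mocExt w) := by
  intro s t hst
  by_cases hs : s ≤ 0
  · rw [mocExt, if_pos hs]
    exact hw.mocExt_nonneg t
  · have hs' : 0 < s := not_le.1 hs
    rw [mocExt_of_pos hs', mocExt_of_pos (hs'.trans_le hst)]
    exact hw.2.1 (lt_min hs' one_pos) (min_le_min_right 1 hst) (min_le_right _ _)

lemma IsMOC.le_one {w : ℝ → ℝ} (hw : IsMOC w) {s : ℝ} (hs : 0 < s) : w s ≤ w 1 := by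
  rcases le_total s 1 with h | h
  · exact hw.2.1 hs h le_rfl
  · exact (hw.2.2 s h).le

lemma IsMOC.mocExt_le_one {w : ℝ → ℝ} (hw : IsMOC w) (s : ℝ) : mocExt w s ≤ w 1 := by
  unfold mocExt
  split_ifs with h
  · exact (hw.1 1 one_pos).le
  · exact hw.le_one (lt_min (not_le.1 h) one_pos)

lemma IsMOC.integral_div_nonneg {w : ℝ → ℝ} (hw : IsMOC w) :
    0 ≤ ∫ t in Ioc (0 : ℝ) 1, w t / t :=
  setIntegral_nonneg measurableSet_Ioc fun t ht => div_nonneg (hw.1 t ht.1).le ht.1.le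

lemma lintegral_mocExt_le {n : ℕ} (hn : 1 ≤ n) {w : ℝ → ℝ} (hw : IsMOC w) (hD : SatisfiesDini w)
    {d : ℝ} (hd : 0 < d) :
    ∫⁻ t in Ioi (0 : ℝ), ENNReal.ofReal ((mocExt w (t / d) / max t d ^ n) ^ 2 / t ^ (n + 1)) *
      ENNReal.ofReal (t ^ n) ≤ ENNReal.ofReal ((diniConst w / d ^ n) ^ 2) := by
  have hw1 := hw.1 1 one_pos
  have hI := hw.integral_div_nonneg
  set D := ∫ t in Ioc (0 : ℝ) 1, w t / t
  have hsimp : ∀ t ∈ Ioi (0 : ℝ),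
      ENNReal.ofReal ((mocExt w (t / d) / max t d ^ n) ^ 2 / t ^ (n + 1)) *
        ENNReal.ofReal (t ^ n) =
      ENNReal.ofReal ((mocExt w (t / d) / max t d ^ n) ^ 2 / t) := fun t ht => by
    have ht' : 0 < t := ht
    rw [← ENNReal.ofReal_mul (by positivity)]
    congr 1
    field_simp
    ring
  rw [setLIntegral_congr_fun measurableSet_Ioi hsimp, ← Ioc_union_Ioi_eq_Ioi hd.le]
  refine (lintegral_union_le _ _ _).trans ?_
  have hscale : IntegrableOn (fun t => d⁻¹ * (w (t / d) / (t / d))) (Ioc 0 d) ∧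
      ∫ t in Ioc 0 d, d⁻¹ * (w (t / d) / (t / d)) = D := by
    have h1 : IntervalIntegrable (fun t => w t / t) volume 0 1 :=
      (intervalIntegrable_iff_integrableOn_Ioc_of_le zero_le_one).2 hD
    have h2 := h1.comp_mul_left (c := d⁻¹)
    have h3 := intervalIntegral.inv_mul_integral_comp_div (a := 0) (b := d)
      (f := fun t => w t / t) d
    rw [zero_div, div_self hd.ne', intervalIntegral.integral_of_le zero_le_one,
      intervalIntegral.integral_of_le hd.le] at h3
    rw [zero_div, one_div, inv_inv, intervalIntegrable_iff_integrableOn_Ioc_of_le hd.le] at h2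
    refine ⟨?_, by rw [integral_const_mul, h3]⟩
    simp_rw [inv_mul_eq_div] at h2
    exact h2.const_mul _
  have hnear : ∫⁻ t in Ioc 0 d, ENNReal.ofReal ((mocExt w (t / d) / max t d ^ n) ^ 2 / t) ≤
      ENNReal.ofReal (w 1 / d ^ (2 * n) * D) := by
    rw [← hscale.2, ← integral_const_mul, ofReal_integral_eq_lintegral_ofReal
      (hscale.1.const_mul _)]
    · refine setLIntegral_mono' measurableSet_Ioc fun t ht => ENNReal.ofReal_le_ofReal ?_
      have ht0 : 0 < t := ht.1
      have htd : t / d ≤ 1 := (div_le_one hd).2 ht.2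
      have hwt := hw.1 (t / d) (by positivity)
      have hle := hw.le_one (show 0 < t / d by positivity)
      rw [mocExt_of_pos (by positivity), min_eq_left htd, max_eq_right ht.2]
      have : w 1 / d ^ (2 * n) * (d⁻¹ * (w (t / d) / (t / d))) =
          w 1 * w (t / d) / d ^ (2 * n) / t := by
        field_simp
      rw [this, div_pow, ← pow_mul, mul_comm n 2, sq]
      gcongr
    · filter_upwards [ae_restrict_mem measurableSet_Ioc] with t ht
      have ht0 : 0 < t := ht.1
      have hwt := hw.1 (t / d) (by positivity)
      simp only [Pi.zero_apply]
      positivity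
  have hfar : ∫⁻ t in Ioi d, ENNReal.ofReal ((mocExt w (t / d) / max t d ^ n) ^ 2 / t) ≤
      ENNReal.ofReal (w 1 ^ 2 * (1 / d ^ (2 * n))) := by
    rw [ENNReal.ofReal_mul (by positivity)]
    refine le_trans ?_ (mul_le_mul_right (lintegral_Ioi_inv_pow_le (by omega) hd) _)
    rw [← lintegral_const_mul' _ _ ENNReal.ofReal_ne_top]
    refine setLIntegral_mono' measurableSet_Ioi fun t ht => ?_
    have ht0 : 0 < t := hd.trans ht
    rw [← ENNReal.ofReal_mul (by positivity)]
    refine ENNReal.ofReal_le_ofReal ?_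
    have h1 := hw.mocExt_nonneg (t / d)
    have h2 := hw.mocExt_le_one (t / d)
    rw [max_eq_left (le_of_lt ht), div_pow, ← pow_mul, mul_comm n 2, div_div, ← pow_succ,
      mul_one_div]
    gcongr
  refine (add_le_add hnear hfar).trans ?_
  rw [← ENNReal.ofReal_add (by positivity) (by positivity)]
  refine ENNReal.ofReal_le_ofReal ?_
  have : (diniConst w / d ^ n) ^ 2 = (D + w 1) ^ 2 / d ^ (2 * n) := by
    rw [div_pow, ← pow_mul, mul_comm n 2, diniConst]
  rw [this, div_mul_eq_mul_div, mul_one_div, ← add_div]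
  gcongr
  nlinarith

lemma one_add_norm_smul_sub {n : ℕ} {t : ℝ} (ht : 0 < t) (y z : Eu n) :
    1 + ‖t⁻¹ • y - t⁻¹ • z‖ = (t + ‖y - z‖) / t := by
  rw [← smul_sub, norm_smul, Real.norm_of_nonneg (by positivity)]
  field_simp

lemma KernelCond.const_nonneg {n : ℕ} {A : ℝ} {ψ : Eu n → Eu n → ℝ} {φ w : ℝ → ℝ}
    (hw : IsMOC w) (h : KernelCond n A ψ φ w) : 0 ≤ A := by
  have h1 := (abs_nonneg _).trans (h.1 0 0)
  rw [mul_assoc] at h1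
  exact nonneg_of_mul_nonneg_left h1
    (mul_pos (maxCubeInd_self_pos n 0) (hw.1 _ (by positivity)))

lemma abs_psiT_le {n : ℕ} {t B a : ℝ} (ht : 0 < t) {ψ : Eu n → Eu n → ℝ} {f : Eu n → ℝ}
    (hf : Integrable f) (hf0 : ∫ y, f y = 0) {y : Eu n} (hB : 0 ≤ B)
    (h : ∀ z, f z ≠ 0 → |ψ (t⁻¹ • y) (t⁻¹ • z) - a| ≤ B) :
    |psiT n ψ t f y| ≤ B / t ^ n * ∫ z, |f z| := by
  rw [psiT, abs_mul, abs_of_pos (show 0 < 1 / t ^ n by positivity)]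
  calc _ ≤ 1 / t ^ n * (B * ∫ z, |f z|) := by
        gcongr
        exact abs_integral_mul_le hf hf0 hB h
    _ = _ := by ring

lemma KernelCond.abs_psiT_le_of_size {n : ℕ} (hn : 1 ≤ n) {A : ℝ} {ψ : Eu n → Eu n → ℝ}
    {φ w : ℝ → ℝ} (hA : 0 ≤ A) (hw : IsMOC w) (h : KernelCond n A ψ φ w) {f : Eu n → ℝ}
    (hf : Integrable f) (hf0 : ∫ y, f y = 0) {t : ℝ} (ht : 0 < t) (y : Eu n) :
    |psiT n ψ t f y| ≤ A * (4 * √n) ^ n * w 1 / t ^ n * ∫ z, |f z| := by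
  have hw1 := hw.1 1 one_pos
  refine abs_psiT_le (a := 0) ht hf hf0 (by positivity) fun z _ => ?_
  rw [sub_zero]
  refine (h.1 _ _).trans ?_
  have h1 : maxCubeInd n (t⁻¹ • y) (t⁻¹ • z) ≤ (4 * √n) ^ n :=
    (maxCubeInd_le hn _ _).trans
      (div_le_self (by positivity) (one_le_pow₀ (by linarith [norm_nonneg (t⁻¹ • y - t⁻¹ • z)])))
  have hpos : 0 < 1 / (1 + ‖t⁻¹ • y - t⁻¹ • z‖) := by positivity
  have := (hw.1 _ hpos).le
  have := hw.le_one hpos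
  gcongr

lemma KernelCond.abs_psiT_le_of_smooth {n : ℕ} (hn : 1 ≤ n) {A : ℝ} {ψ : Eu n → Eu n → ℝ}
    {φ w : ℝ → ℝ} (hA : 0 ≤ A) (hφ : IsMOC φ) (hw : IsMOC w) (h : KernelCond n A ψ φ w)
    {c : Eu n} {ℓ : ℝ} (hℓ : 0 < ℓ) {f : Eu n → ℝ}
    (hf : Integrable f) (hf0 : ∫ y, f y = 0) (hsupp : ∀ x, x ∉ ccube n c ℓ → f x = 0)
    {x : Eu n} (hx : 2 * √n * ℓ ≤ ‖x - c‖) {t : ℝ} (ht : 0 < t) {y : Eu n}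
    (hxy : ‖x - y‖ < t) (hy : √n * ℓ < ‖y - c‖) :
    |psiT n ψ t f y| ≤ A * (4 * √n) ^ n * φ (2 * √n * ℓ / ‖x - c‖) * (∫ z, |f z|) *
      (mocExt w (t / ‖x - c‖) / max t ‖x - c‖ ^ n) := by
  have hsq := one_le_sqrt_natCast hn
  have hd : 0 < ‖x - c‖ := lt_of_lt_of_le (by positivity) hx
  have hyc : 0 < ‖y - c‖ := lt_of_le_of_lt (by positivity) hy
  have htri : ‖x - c‖ ≤ t + ‖y - c‖ := by
    have := norm_add_le (x - y) (y - c)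
    rw [sub_add_sub_cancel] at this
    linarith
  set d := ‖x - c‖
  set r := ‖y - c‖
  have hφ1 := hφ.1 (2 * √n * ℓ / d) (by positivity)
  have hW := hw.mocExt_nonneg (t / d)
  have hN : 0 ≤ ∫ z, |f z| := integral_nonneg fun _ => abs_nonneg _
  have hmax : 0 < max t d := lt_max_of_lt_left ht
  have key : ∀ z, f z ≠ 0 → |ψ (t⁻¹ • y) (t⁻¹ • z) - ψ (t⁻¹ • y) (t⁻¹ • c)| ≤
      A * ((4 * √n) ^ n * t ^ n / max t d ^ n) * φ (2 * √n * ℓ / d) * mocExt w (t / d) := by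
    intro z hz
    have hzQ : ‖z - c‖ ≤ √n * (ℓ / 2) :=
      norm_sub_le_of_mem_ccube hℓ.le (not_not.1 (mt (hsupp z) hz))
    by_cases hzc : z = c
    · rw [hzc, sub_self, abs_zero]
      positivity
    have hzc' : 0 < ‖z - c‖ := norm_pos_iff.2 (sub_ne_zero.2 hzc)
    have hnorm : ‖t⁻¹ • z - t⁻¹ • c‖ = ‖z - c‖ / t := by
      rw [← smul_sub, norm_smul, Real.norm_of_nonneg (by positivity), inv_mul_eq_div]
    have hnorm' : ‖t⁻¹ • y - t⁻¹ • c‖ = r / t := by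
      rw [← smul_sub, norm_smul, Real.norm_of_nonneg (by positivity), inv_mul_eq_div]
    have h3 := h.2.2 (t⁻¹ • y) (t⁻¹ • c) (t⁻¹ • z - t⁻¹ • c) (by
      rw [hnorm, hnorm', div_right_comm]
      gcongr
      linarith)
    rw [add_sub_cancel, abs_sub_comm] at h3
    refine h3.trans ?_
    have hM := maxCubeInd_le hn (t⁻¹ • y) (t⁻¹ • c)
    have hM0 := maxCubeInd_nonneg n (t⁻¹ • y) (t⁻¹ • c)
    rw [one_add_norm_smul_sub ht, hnorm] at *
    have hs : ‖z - c‖ / t / ((t + r) / t) = ‖z - c‖ / (t + r) := by field_simp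
    rw [hs, one_div_div]
    have hφle : φ (‖z - c‖ / (t + r)) ≤ φ (2 * √n * ℓ / d) := by
      refine hφ.2.1 (by positivity) ?_ ((div_le_one hd).2 hx)
      gcongr
      nlinarith
    have hwle : w (t / (t + r)) ≤ mocExt w (t / d) := by
      have h1 : t / (t + r) ≤ 1 := (div_le_one (by positivity)).2 (by linarith)
      have h2 := mocExt_of_pos (w := w) (show 0 < t / (t + r) by positivity)
      rw [min_eq_left h1] at h2
      rw [← h2]
      apply hw.monotone_mocExt
      gcongr
    have hMle : maxCubeInd n (t⁻¹ • y) (t⁻¹ • c) ≤ (4 * √n) ^ n * t ^ n / max t d ^ n := by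
      refine hM.trans ?_
      rw [div_pow, div_div_eq_mul_div]
      gcongr
      exact max_le (by linarith) htri
    have := (hφ.1 (‖z - c‖ / (t + r)) (by positivity)).le
    have := (hw.1 (t / (t + r)) (by positivity)).le
    gcongr
  refine (abs_psiT_le ht hf hf0 (by positivity) key).trans_eq ?_
  field_simp
/-- A single term of the series, the one with `2 ^ (k + 1) * ℓ` comparable to `d`, controls the
contribution of the points of the cone close to the cube. -/
lemma exists_rpow_div_mul_ge {n : ℕ} {w : ℝ → ℝ} (hw : IsMOC w) {ℓ d : ℝ} (hℓ : 0 < ℓ)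
    (hd : ℓ ≤ d) : ∃ k : ℕ, ℓ ^ n / d ^ (3 * n) * w 1 ^ 2 ≤
      18 ^ n * ((2 : ℝ) ^ (-(((k : ℝ) + 1) * n) / 2) / (2 ^ (k + 1) * ℓ + d) ^ n *
        w (2 ^ (k + 3) * ℓ / (2 ^ (k + 1) * ℓ + d))) ^ 2 := by
  have hd0 : 0 < d := hℓ.trans_le hd
  obtain ⟨k, hk1, hk2⟩ := exists_nat_pow_near ((one_le_div hℓ).2 hd) (one_lt_two (α := ℝ))
  rw [le_div_iff₀ hℓ] at hk1
  rw [div_lt_iff₀ hℓ] at hk2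
  refine ⟨k, ?_⟩
  have hw1 := hw.1 1 one_pos
  have hpow : (2 : ℝ) ^ (k + 3) = 4 * 2 ^ (k + 1) := by ring
  have hweq : w (2 ^ (k + 3) * ℓ / (2 ^ (k + 1) * ℓ + d)) = w 1 := by
    refine hw.2.2 _ ((one_le_div (by positivity)).2 ?_)
    rw [hpow]
    nlinarith
  have hrpow : ((2 : ℝ) ^ (-(((k : ℝ) + 1) * n) / 2)) ^ 2 = 1 / (2 ^ (k + 1)) ^ n := by
    rw [← Real.rpow_natCast, ← Real.rpow_mul zero_le_two,
      show -(((k : ℝ) + 1) * n) / 2 * (2 : ℕ) = -(((k + 1) * n : ℕ) : ℝ) by push_cast; ring,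
      Real.rpow_neg zero_le_two, Real.rpow_natCast, pow_mul, one_div]
  have h2k : (2 : ℝ) ^ (k + 1) ≤ 2 * (d / ℓ) := by
    rw [mul_div_assoc', le_div_iff₀ hℓ, pow_succ]
    linarith
  have hsum : 2 ^ (k + 1) * ℓ + d ≤ 3 * d := by
    rw [pow_succ]
    linarith
  rw [hweq, mul_pow, div_pow, hrpow, ← mul_assoc]
  gcongr
  calc ℓ ^ n / d ^ (3 * n) = 18 ^ n * (1 / (2 * (d / ℓ)) ^ n / ((3 * d) ^ n) ^ 2) := by
        have h18 : (18 : ℝ) ^ n = 2 ^ n * (3 ^ n) ^ 2 := by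
          rw [← pow_mul, mul_comm n 2, pow_mul, ← mul_pow]
          norm_num
        rw [h18, mul_pow, mul_pow, div_pow]
        field_simp
        ring
    _ ≤ _ := by gcongr

lemma summable_rpow_div_mul {n : ℕ} (hn : 1 ≤ n) {w : ℝ → ℝ} (hw : IsMOC w) {ℓ d : ℝ}
    (hℓ : 0 < ℓ) (hd : 0 < d) :
    Summable fun k : ℕ => (2 : ℝ) ^ (-(((k : ℝ) + 1) * n) / 2) / (2 ^ (k + 1) * ℓ + d) ^ n *
      w (2 ^ (k + 3) * ℓ / (2 ^ (k + 1) * ℓ + d)) := by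
  have hw1 := hw.1 1 one_pos
  have hgeom : Summable fun k : ℕ => ((2 : ℝ) ^ (-(1 / 2) : ℝ)) ^ k :=
    summable_geometric_of_lt_one (by positivity)
      (Real.rpow_lt_one_of_one_lt_of_neg one_lt_two (by norm_num))
  refine .of_nonneg_of_le (fun k => ?_) (fun k => ?_) ((hgeom.div_const (d ^ n)).mul_right (w 1))
  · have := hw.1 (2 ^ (k + 3) * ℓ / (2 ^ (k + 1) * ℓ + d)) (by positivity)
    positivity
  · have h1 := hw.1 (2 ^ (k + 3) * ℓ / (2 ^ (k + 1) * ℓ + d)) (by positivity)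
    have h2 := hw.le_one (s := 2 ^ (k + 3) * ℓ / (2 ^ (k + 1) * ℓ + d)) (by positivity)
    have h3 : (2 : ℝ) ^ (-(((k : ℝ) + 1) * n) / 2) ≤ ((2 : ℝ) ^ (-(1 / 2) : ℝ)) ^ k := by
      rw [← Real.rpow_natCast, ← Real.rpow_mul zero_le_two]
      refine Real.rpow_le_rpow_of_exponent_le one_le_two ?_
      have : (1 : ℝ) ≤ n := by exact_mod_cast hn
      nlinarith [(Nat.cast_nonneg k : (0 : ℝ) ≤ k)]
    have h4 : d ≤ 2 ^ (k + 1) * ℓ + d := by linarith [show 0 < 2 ^ (k + 1) * ℓ by positivity]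
    gcongr

lemma integral_le_of_lintegral_le {X : Type*} [MeasurableSpace X] {μ : Measure X} {f : X → ℝ}
    (hf : 0 ≤ᵐ[μ] f) {b : ℝ} (hb : 0 ≤ b) (h : ∫⁻ x, ENNReal.ofReal (f x) ∂μ ≤ ENNReal.ofReal b) :
    ∫ x, f x ∂μ ≤ b := by
  by_cases hm : AEStronglyMeasurable f μ
  · rw [integral_eq_lintegral_of_nonneg_ae hf hm]
    exact ENNReal.toReal_le_of_le_ofReal hb h
  · rwa [integral_non_aestronglyMeasurable hm]

lemma lintegral_prod_indicator_le {n : ℕ} (hn : 1 ≤ n) (c : Eu n) {R a b : ℝ} (hR : 0 < R)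
    (ha : 0 < a) (hb : 0 ≤ b) (s : Set (Eu n × ℝ)) :
    ∫⁻ p in s, (Metric.closedBall c R ×ˢ Ioi a).indicator
      (fun p => ENNReal.ofReal (b / p.2 ^ (3 * n + 1))) p ≤
    ENNReal.ofReal (volume.real (Metric.ball (0 : Eu n) 1) * R ^ n * (b / a ^ (3 * n))) := by
  refine (setLIntegral_le_lintegral _ _).trans ?_
  rw [lintegral_indicator (measurableSet_closedBall.prod measurableSet_Ioi),
    Measure.volume_eq_prod, ← Measure.prod_restrict]
  have h := lintegral_prod_mul (μ := volume.restrict (Metric.closedBall c R))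
    (ν := volume.restrict (Ioi a)) (f := fun _ => (1 : ENNReal))
    (g := fun t => ENNReal.ofReal (b / t ^ (3 * n + 1))) aemeasurable_const
    (by fun_prop)
  simp only [one_mul] at h
  rw [h, setLIntegral_const, one_mul, Measure.addHaar_closedBall _ _ hR.le,
    ENNReal.ofReal_mul (by positivity), mul_comm (volume.real _),
    ENNReal.ofReal_mul (by positivity), Measure.real,
    ENNReal.ofReal_toReal measure_ball_lt_top.ne, finrank_euclideanSpace, Fintype.card_fin]
  gcongr
  rw [div_eq_mul_one_div b, ENNReal.ofReal_mul hb]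
  refine le_trans ?_ (mul_le_mul_right (lintegral_Ioi_inv_pow_le (by omega) ha) _)
  rw [← lintegral_const_mul' _ _ ENNReal.ofReal_ne_top]
  refine lintegral_mono fun t => ?_
  rw [← ENNReal.ofReal_mul hb, mul_one_div]

lemma KernelCond.integral_cone_le {n : ℕ} (hn : 1 ≤ n) {A : ℝ} {ψ : Eu n → Eu n → ℝ}
    {φ w : ℝ → ℝ} (hA : 0 ≤ A) (hφ : IsMOC φ) (hw : IsMOC w) (hD : SatisfiesDini w)
    (h : KernelCond n A ψ φ w) {c : Eu n} {ℓ : ℝ} (hℓ : 0 < ℓ) {f : Eu n → ℝ}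
    (hf : Integrable f) (hf0 : ∫ y, f y = 0) (hsupp : ∀ x, x ∉ ccube n c ℓ → f x = 0)
    {x : Eu n} (hx : 2 * √n * ℓ ≤ ‖x - c‖) :
    ∫ p in cone n 1 x, psiT n ψ p.2 f p.1 ^ 2 / p.2 ^ (n + 1) ≤
      volume.real (Metric.ball (0 : Eu n) 1) *
        (A * (4 * √n) ^ n * φ (2 * √n * ℓ / ‖x - c‖) * (∫ z, |f z|)) ^ 2 *
          (diniConst w / ‖x - c‖ ^ n) ^ 2 +
      volume.real (Metric.ball (0 : Eu n) 1) * (√n * ℓ) ^ n *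
        ((A * (4 * √n) ^ n * w 1 * ∫ z, |f z|) ^ 2 / (‖x - c‖ / 2) ^ (3 * n)) := by
  have hsq := one_le_sqrt_natCast hn
  have hd : 0 < ‖x - c‖ := lt_of_lt_of_le (by positivity) hx
  set d := ‖x - c‖
  set V := volume.real (Metric.ball (0 : Eu n) 1) with hV
  set B₁ := A * (4 * √n) ^ n * φ (2 * √n * ℓ / d) * (∫ z, |f z|) with hB₁
  set B₂ := A * (4 * √n) ^ n * w 1 * ∫ z, |f z| with hB₂
  have hV0 : 0 < V := volume_real_unit_ball_pos n
  have hmeas := measurableSet_cone n 1 x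
  refine integral_le_of_lintegral_le ?_ (by positivity) ?_
  · filter_upwards [ae_restrict_mem hmeas] with p hp
    have : 0 < p.2 := hp.1
    simp only [Pi.zero_apply]
    positivity
  set g : ℝ → ENNReal := fun t => ENNReal.ofReal (B₁ ^ 2) *
    ENNReal.ofReal ((mocExt w (t / d) / max t d ^ n) ^ 2 / t ^ (n + 1)) with hg
  have hWm := hw.monotone_mocExt.measurable
  have hgm : Measurable g := by fun_prop
  calc _ ≤ ∫⁻ p in cone n 1 x, (g p.2 + (Metric.closedBall c (√n * ℓ) ×ˢ Ioi (d / 2)).indicator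
          (fun p => ENNReal.ofReal (B₂ ^ 2 / p.2 ^ (3 * n + 1))) p) := by
        refine setLIntegral_mono' hmeas fun p hp => ?_
        obtain ⟨y, t⟩ := p
        obtain ⟨ht, hxy⟩ : 0 < t ∧ ‖x - y‖ < 1 * t := hp
        rw [one_mul] at hxy
        rcases le_or_gt ‖y - c‖ (√n * ℓ) with hy | hy
        · have htd : d / 2 < t := by
            have := norm_add_le (x - y) (y - c)
            rw [sub_add_sub_cancel] at this
            change d ≤ _ at this
            linarith
          have hmem : (y, t) ∈ Metric.closedBall c (√n * ℓ) ×ˢ Ioi (d / 2) :=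
            ⟨mem_closedBall_iff_norm.2 hy, htd⟩
          rw [indicator_of_mem hmem]
          refine le_add_of_nonneg_of_le zero_le (ENNReal.ofReal_le_ofReal ?_)
          have h1 := h.abs_psiT_le_of_size hn hA hw hf hf0 ht y
          have h2 : A * (4 * √n) ^ n * w 1 / t ^ n * ∫ z, |f z| = B₂ / t ^ n := by
            rw [hB₂]
            ring
          rw [h2] at h1
          calc psiT n ψ t f y ^ 2 / t ^ (n + 1) ≤ (B₂ / t ^ n) ^ 2 / t ^ (n + 1) := by
                rw [← sq_abs]
                gcongr
            _ = B₂ ^ 2 / t ^ (3 * n + 1) := by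
                rw [div_pow, div_div]
                congr 1
                ring
        · refine le_add_of_le_of_nonneg ?_ zero_le
          have h1 := h.abs_psiT_le_of_smooth hn hA hφ hw hℓ hf hf0 hsupp hx ht hxy hy
          rw [hg]
          simp only
          rw [← ENNReal.ofReal_mul (by positivity), mul_div_assoc', ← mul_pow]
          refine ENNReal.ofReal_le_ofReal ?_
          rw [← sq_abs]
          gcongr
    _ = ENNReal.ofReal (B₁ ^ 2) * (volume (Metric.ball (0 : Eu n) 1) * ∫⁻ t in Ioi (0 : ℝ),
          ENNReal.ofReal ((mocExt w (t / d) / max t d ^ n) ^ 2 / t ^ (n + 1)) *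
            ENNReal.ofReal (t ^ n)) +
        ∫⁻ p in cone n 1 x, (Metric.closedBall c (√n * ℓ) ×ˢ Ioi (d / 2)).indicator
          (fun p => ENNReal.ofReal (B₂ ^ 2 / p.2 ^ (3 * n + 1))) p := by
        rw [lintegral_add_left (show Measurable fun p : Eu n × ℝ => g p.2 from
          hgm.comp measurable_snd), lintegral_cone_comp_snd x hgm, hg]
        simp_rw [mul_assoc]
        rw [lintegral_const_mul' _ _ ENNReal.ofReal_ne_top, mul_left_comm]
    _ ≤ ENNReal.ofReal (B₁ ^ 2) * (ENNReal.ofReal V *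
          ENNReal.ofReal ((diniConst w / d ^ n) ^ 2)) +
        ENNReal.ofReal (V * (√n * ℓ) ^ n * (B₂ ^ 2 / (d / 2) ^ (3 * n))) := by
        rw [hV, Measure.real, ENNReal.ofReal_toReal measure_ball_lt_top.ne]
        gcongr
        · exact lintegral_mocExt_le hn hw hD hd
        · exact lintegral_prod_indicator_le hn c (by positivity) (by positivity) (sq_nonneg _) _
    _ = _ := by
        rw [← ENNReal.ofReal_mul hV0.le, ← ENNReal.ofReal_mul (sq_nonneg _),
          ← ENNReal.ofReal_add (by positivity) (by positivity)]
        congr 1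
        ring

/-- pointwise bound for `S_{1,ψ} f(x)` far from the cube `Q`
supporting the mean-zero function `f`, with `C` depending only on `n`. -/
theorem stmt9 (n : ℕ) (hn : 1 ≤ n) :
    ∃ C > 0, ∀ (A : ℝ) (ψ : Eu n → Eu n → ℝ) (φ w : ℝ → ℝ),
      IsMOC φ → IsMOC w → SatisfiesDini w → KernelCond n A ψ φ w →
      ∀ (c : Eu n) (ℓ : ℝ), 0 < ℓ →
      ∀ f : Eu n → ℝ, Integrable f volume →
        (∀ x, x ∉ ccube n c ℓ → f x = 0) → (∫ x : Eu n, f x) = 0 →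
        ∀ x : Eu n, 64 * n * ℓ < ‖x - c‖ →
          sqFn n 1 ψ f x ≤
            C * (A * diniConst w / ‖x - c‖ ^ n *
                  φ (2 * Real.sqrt n * ℓ / ‖x - c‖) * (∫ y : Eu n, |f y|) +
              ∑' k : ℕ,
                A * (2 : ℝ) ^ (-(((k : ℝ) + 1) * n) / 2) /
                    (2 ^ (k + 1) * ℓ + ‖x - c‖) ^ n *
                  w (2 ^ (k + 3) * ℓ / (2 ^ (k + 1) * ℓ + ‖x - c‖)) *
                  (∫ y : Eu n, |f y|)) := by
  set V := volume.real (Metric.ball (0 : Eu n) 1) with hV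
  have hV0 : 0 < V := volume_real_unit_ball_pos n
  have hsq := one_le_sqrt_natCast hn
  set C := √(V * ((4 * √n) ^ n) ^ 2 * (√n) ^ n * 144 ^ n) with hC
  have hCsq : C ^ 2 = V * ((4 * √n) ^ n) ^ 2 * (√n) ^ n * 144 ^ n := Real.sq_sqrt (by positivity)
  have hC0 : 0 < C := Real.sqrt_pos.2 (by positivity)
  refine ⟨C, hC0, fun A ψ φ w hφ hw hD h c ℓ hℓ f hf hsupp hf0 x hx => ?_⟩
  have hA := h.const_nonneg hw
  have hw1 := hw.1 1 one_pos
  have hn' : √(n : ℝ) ≤ n := by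
    rw [Real.sqrt_le_left (by positivity)]
    exact_mod_cast Nat.le_self_pow two_ne_zero n
  have hnℓ : √(n : ℝ) * ℓ ≤ n * ℓ := by gcongr
  have hℓn : ℓ ≤ √(n : ℝ) * ℓ := le_mul_of_one_le_left hℓ.le hsq
  have hdℓ : ℓ ≤ ‖x - c‖ := by linarith
  have hmain := h.integral_cone_le hn hA hφ hw hD hℓ hf hf0 hsupp (x := x) (by linarith)
  have hd : 0 < ‖x - c‖ := hℓ.trans_le hdℓ
  obtain ⟨k, hk⟩ := exists_rpow_div_mul_ge (n := n) hw hℓ hdℓ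
  have hsumm := summable_rpow_div_mul hn hw hℓ hd
  have hN : 0 ≤ ∫ z, |f z| := integral_nonneg fun _ => abs_nonneg _
  have hDini : 0 ≤ diniConst w := add_nonneg hw.integral_div_nonneg hw1.le
  have hφ1 := hφ.1 (2 * √n * ℓ / ‖x - c‖) (by positivity)
  set d := ‖x - c‖
  set N := ∫ z, |f z|
  set T : ℕ → ℝ := fun k => (2 : ℝ) ^ (-(((k : ℝ) + 1) * n) / 2) / (2 ^ (k + 1) * ℓ + d) ^ n *
    w (2 ^ (k + 3) * ℓ / (2 ^ (k + 1) * ℓ + d)) with hT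
  change _ ≤ 18 ^ n * T k ^ 2 at hk
  have hT0 : ∀ j, 0 ≤ T j := fun j => by
    have := hw.1 (2 ^ (j + 3) * ℓ / (2 ^ (j + 1) * ℓ + d)) (by positivity)
    positivity
  have htsum : A * N * T k ≤ ∑' k : ℕ, A * (2 : ℝ) ^ (-(((k : ℝ) + 1) * n) / 2) /
      (2 ^ (k + 1) * ℓ + d) ^ n * w (2 ^ (k + 3) * ℓ / (2 ^ (k + 1) * ℓ + d)) * N := by
    have hterm : ∀ j : ℕ, A * (2 : ℝ) ^ (-(((j : ℝ) + 1) * n) / 2) /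
        (2 ^ (j + 1) * ℓ + d) ^ n * w (2 ^ (j + 3) * ℓ / (2 ^ (j + 1) * ℓ + d)) * N =
        A * N * T j := fun j => by
      rw [hT]
      ring
    simp_rw [hterm, tsum_mul_left]
    gcongr
    exact hsumm.le_tsum k fun j _ => hT0 j
  refine le_trans ?_ (mul_le_mul_of_nonneg_left (add_le_add_right htsum _) hC0.le)
  set X := A * diniConst w / d ^ n * φ (2 * √n * ℓ / d) * N with hX
  have hX0 : 0 ≤ X := by positivity
  have hY0 : 0 ≤ A * N * T k := mul_nonneg (by positivity) (hT0 k)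
  refine Real.sqrt_le_iff.2 ⟨by positivity, hmain.trans ?_⟩
  have hfar : V * (A * (4 * √n) ^ n * φ (2 * √n * ℓ / d) * N) ^ 2 * (diniConst w / d ^ n) ^ 2 ≤
      C ^ 2 * X ^ 2 := by
    have h1 : 1 ≤ (√n) ^ n * (144 : ℝ) ^ n :=
      one_le_mul_of_one_le_of_one_le (one_le_pow₀ hsq) (one_le_pow₀ (by norm_num))
    calc _ = V * ((4 * √n) ^ n) ^ 2 * X ^ 2 * 1 := by
          rw [hX]
          ring
      _ ≤ V * ((4 * √n) ^ n) ^ 2 * X ^ 2 * ((√n) ^ n * (144 : ℝ) ^ n) := by gcongr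
      _ = C ^ 2 * X ^ 2 := by
          rw [hCsq]
          ring
  have hnear : V * (√n * ℓ) ^ n * ((A * (4 * √n) ^ n * w 1 * N) ^ 2 / (d / 2) ^ (3 * n)) ≤
      C ^ 2 * (A * N * T k) ^ 2 := by
    calc _ = V * ((4 * √n) ^ n) ^ 2 * (√n) ^ n * 8 ^ n * (A * N) ^ 2 *
            (ℓ ^ n / d ^ (3 * n) * w 1 ^ 2) := by
          rw [div_pow, pow_mul 2 3 n, show (2 : ℝ) ^ 3 = 8 by norm_num, mul_pow √(n : ℝ) ℓ n]
          field_simp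
      _ ≤ V * ((4 * √n) ^ n) ^ 2 * (√n) ^ n * 8 ^ n * (A * N) ^ 2 * (18 ^ n * T k ^ 2) := by
          gcongr
      _ = C ^ 2 * (A * N * T k) ^ 2 := by
          rw [hCsq, show (144 : ℝ) = 8 * 18 by norm_num, mul_pow 8 18 n]
          ring
  have hcross : 0 ≤ C ^ 2 * (X * (A * N * T k)) := by positivity
  calc _ ≤ C ^ 2 * X ^ 2 + C ^ 2 * (A * N * T k) ^ 2 := add_le_add hfar hnear
    _ ≤ (C * (X + A * N * T k)) ^ 2 := by linarith

end
end
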